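/- Simulation of call-by-name algebraic equality by call-by-value algebraic equality: let S_a be a fragment of the call-by-name calculus and S_ℓ a fragment of the call-by-value calculus such that for every M ∈ S_a, (⟦M⟧) λx.x ∈ S_ℓ. Then for every closed term M ∈ S_a and every value V, if M (=a∪β^{S_a})* V, then (⟦M⟧) λx.x (=ℓ∪β^{S_ℓ})* Φ(V). (Here R* denotes the reflexive-transitive closure of a relation R.) -/

import Mathlib

namespace AlgLam

/-- Terms of the algebraic λ-calculus over a ring of scalars `R`,
    in de Bruijn representation. -/
inductive Term (R : Type u) : Type u
  | var : ℕ → Term R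
  | lam : Term R → Term R
  | app : Term R → Term R → Term R
  | zero : Term R
  | smul : R → Term R → Term R
  | add : Term R → Term R → Term R

namespace Term

variable {R : Type u}

/-- De Bruijn lifting: shift the free indices `≥ d` up by one. -/
def lift (d : ℕ) : Term R → Term R
  | var n => if n < d then var n else var (n + 1)
  | lam M => lam (lift (d + 1) M)
  | app M N => app (lift d M) (lift d N)
  | zero => zero
  | smul a M => smul a (lift d M)
  | add M N => add (lift d M) (lift d N)

/-- Capture-avoiding substitution of `N` for the free de Bruijn index `d`. -/
def subst (d : ℕ) (N : Term R) : Term R → Term R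
  | var n => if n < d then var n else if n = d then N else var (n - 1)
  | lam M => lam (subst (d + 1) (lift 0 N) M)
  | app M L => app (subst d N M) (subst d N L)
  | zero => zero
  | smul a M => smul a (subst d N M)
  | add M L => add (subst d N M) (subst d N L)

/-- Base terms: variables and λ-abstractions. -/
inductive IsBase : Term R → Prop
  | var (n : ℕ) : IsBase (var n)
  | lam (M : Term R) : IsBase (lam M)

/-- Values: `0`, base terms, scalar multiples of values, sums of values. -/
inductive IsValue : Term R → Prop
  | zero : IsValue zero
  | base {B : Term R} : IsBase B → IsValue B
  | smul (a : R) {V : Term R} : IsValue V → IsValue (smul a V)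
  | add {V W : Term R} : IsValue V → IsValue W → IsValue (add V W)

/-- `ClosedUnder d M` : every free index of `M` is `< d`. -/
def ClosedUnder : ℕ → Term R → Prop
  | d, var n => n < d
  | d, lam M => ClosedUnder (d + 1) M
  | d, app M N => ClosedUnder d M ∧ ClosedUnder d N
  | _, zero => True
  | d, smul _ M => ClosedUnder d M
  | d, add M N => ClosedUnder d M ∧ ClosedUnder d N

/-- A closed term (a program). -/
def Closed (M : Term R) : Prop := ClosedUnder 0 M

section Rules

variable [CommRing R]

/-- The rewrite relation `→a` of the call-by-name algebraic λ-calculus: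
    ring rules and call-by-name application rules, closed under the ξ contexts. -/
inductive StepA : Term R → Term R → Prop
  -- ring rules
  | assocL (M N L : Term R) : StepA (add M (add N L)) (add (add M N) L)
  | assocR (M N L : Term R) : StepA (add (add M N) L) (add M (add N L))
  | comm (M N : Term R) : StepA (add M N) (add N M)
  | factor (a b : R) (M : Term R) : StepA (add (smul a M) (smul b M)) (smul (a + b) M)
  | factor1 (a : R) (M : Term R) : StepA (add (smul a M) M) (smul (a + 1) M)
  | factor11 (M : Term R) : StepA (add M M) (smul (1 + 1) M)
  | mulMul (a b : R) (M : Term R) : StepA (smul a (smul b M)) (smul (a * b) M)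
  | mulDist (a : R) (M N : Term R) : StepA (smul a (add M N)) (add (smul a M) (smul a N))
  | oneSmul (M : Term R) : StepA (smul 1 M) M
  | zeroSmul (M : Term R) : StepA (smul 0 M) zero
  | smulZero (a : R) : StepA (smul a zero) zero
  | zeroAdd (M : Term R) : StepA (add zero M) M
  -- call-by-name application rules (A)
  | appAdd (M N L : Term R) : StepA (app (add M N) L) (add (app M L) (app N L))
  | appSmul (a : R) (M N : Term R) : StepA (app (smul a M) N) (smul a (app M N))
  | appZero (M : Term R) : StepA (app zero M) zero
  -- ξ context rules
  | ctxAppL {M M' : Term R} (N : Term R) : StepA M M' → StepA (app M N) (app M' N)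
  | ctxAddL {M M' : Term R} (N : Term R) : StepA M M' → StepA (add M N) (add M' N)
  | ctxAddR {N N' : Term R} (M : Term R) : StepA N N' → StepA (add M N) (add M N')
  | ctxSmul (a : R) {M M' : Term R} : StepA M M' → StepA (smul a M) (smul a M')

/-- The call-by-name β-reduction `→βn`, closed under the ξ contexts. -/
inductive StepBn : Term R → Term R → Prop
  | beta (M N : Term R) : StepBn (app (lam M) N) (subst 0 N M)
  | ctxAppL {M M' : Term R} (N : Term R) : StepBn M M' → StepBn (app M N) (app M' N)
  | ctxAddL {M M' : Term R} (N : Term R) : StepBn M M' → StepBn (add M N) (add M' N)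
  | ctxAddR {N N' : Term R} (M : Term R) : StepBn N N' → StepBn (add M N) (add M N')
  | ctxSmul (a : R) {M M' : Term R} : StepBn M M' → StepBn (smul a M) (smul a M')

/-- The rewrite relation `→a∪β`. -/
def StepAB (M N : Term R) : Prop := StepA M N ∨ StepBn M N

/-- The rewrite relation `→ℓ` of the call-by-value algebraic λ-calculus:
    ring rules, left- and right-linearity rules, closed under ξ and ξ_lin. -/
inductive StepL : Term R → Term R → Prop
  -- ring rules
  | assocL (M N L : Term R) : StepL (add M (add N L)) (add (add M N) L)
  | assocR (M N L : Term R) : StepL (add (add M N) L) (add M (add N L))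
  | comm (M N : Term R) : StepL (add M N) (add N M)
  | factor (a b : R) (M : Term R) : StepL (add (smul a M) (smul b M)) (smul (a + b) M)
  | factor1 (a : R) (M : Term R) : StepL (add (smul a M) M) (smul (a + 1) M)
  | factor11 (M : Term R) : StepL (add M M) (smul (1 + 1) M)
  | mulMul (a b : R) (M : Term R) : StepL (smul a (smul b M)) (smul (a * b) M)
  | mulDist (a : R) (M N : Term R) : StepL (smul a (add M N)) (add (smul a M) (smul a N))
  | oneSmul (M : Term R) : StepL (smul 1 M) M
  | zeroSmul (M : Term R) : StepL (smul 0 M) zero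
  | smulZero (a : R) : StepL (smul a zero) zero
  | zeroAdd (M : Term R) : StepL (add zero M) M
  -- left linearity (A_l), the argument must be a value
  | appAddV {V : Term R} (M N : Term R) : IsValue V →
      StepL (app (add M N) V) (add (app M V) (app N V))
  | appSmulV {V : Term R} (a : R) (M : Term R) : IsValue V →
      StepL (app (smul a M) V) (smul a (app M V))
  | appZeroV {V : Term R} : IsValue V → StepL (app zero V) zero
  -- right linearity (A_r), the function must be a base term
  | appAddB {B : Term R} (M N : Term R) : IsBase B →
      StepL (app B (add M N)) (add (app B M) (app B N))
  | appSmulB {B : Term R} (a : R) (M : Term R) : IsBase B →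
      StepL (app B (smul a M)) (smul a (app B M))
  | appZeroB {B : Term R} : IsBase B → StepL (app B zero) zero
  -- ξ context rules
  | ctxAppL {M M' : Term R} (N : Term R) : StepL M M' → StepL (app M N) (app M' N)
  | ctxAddL {M M' : Term R} (N : Term R) : StepL M M' → StepL (add M N) (add M' N)
  | ctxAddR {N N' : Term R} (M : Term R) : StepL N N' → StepL (add M N) (add M N')
  | ctxSmul (a : R) {M M' : Term R} : StepL M M' → StepL (smul a M) (smul a M')
  -- ξ_lin context rule
  | ctxAppR {V M M' : Term R} : IsValue V → StepL M M' → StepL (app V M) (app V M')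

/-- The call-by-value β-reduction `→βv`, closed under ξ and ξ_lin. -/
inductive StepBv : Term R → Term R → Prop
  | beta (M : Term R) {B : Term R} : IsBase B → StepBv (app (lam M) B) (subst 0 B M)
  | ctxAppL {M M' : Term R} (N : Term R) : StepBv M M' → StepBv (app M N) (app M' N)
  | ctxAddL {M M' : Term R} (N : Term R) : StepBv M M' → StepBv (add M N) (add M' N)
  | ctxAddR {N N' : Term R} (M : Term R) : StepBv N N' → StepBv (add M N) (add M N')
  | ctxSmul (a : R) {M M' : Term R} : StepBv M M' → StepBv (smul a M) (smul a M')
  | ctxAppR {V M M' : Term R} : IsValue V → StepBv M M' → StepBv (app V M) (app V M')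

/-- The rewrite relation `→ℓ∪β`. -/
def StepLB (M N : Term R) : Prop := StepL M N ∨ StepBv M N

end Rules

/-- Steps of `→a` performed by an associativity or commutativity rule
    (closed under the ξ contexts). -/
inductive StepACa : Term R → Term R → Prop
  | assocL (M N L : Term R) : StepACa (add M (add N L)) (add (add M N) L)
  | assocR (M N L : Term R) : StepACa (add (add M N) L) (add M (add N L))
  | comm (M N : Term R) : StepACa (add M N) (add N M)
  | ctxAppL {M M' : Term R} (N : Term R) : StepACa M M' → StepACa (app M N) (app M' N)
  | ctxAddL {M M' : Term R} (N : Term R) : StepACa M M' → StepACa (add M N) (add M' N)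
  | ctxAddR {N N' : Term R} (M : Term R) : StepACa N N' → StepACa (add M N) (add M N')
  | ctxSmul (a : R) {M M' : Term R} : StepACa M M' → StepACa (smul a M) (smul a M')

/-- Steps of `→ℓ` performed by an associativity or commutativity rule
    (closed under the ξ and ξ_lin contexts). -/
inductive StepACl : Term R → Term R → Prop
  | assocL (M N L : Term R) : StepACl (add M (add N L)) (add (add M N) L)
  | assocR (M N L : Term R) : StepACl (add (add M N) L) (add M (add N L))
  | comm (M N : Term R) : StepACl (add M N) (add N M)
  | ctxAppL {M M' : Term R} (N : Term R) : StepACl M M' → StepACl (app M N) (app M' N)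
  | ctxAddL {M M' : Term R} (N : Term R) : StepACl M M' → StepACl (add M N) (add M' N)
  | ctxAddR {N N' : Term R} (M : Term R) : StepACl N N' → StepACl (add M N) (add M N')
  | ctxSmul (a : R) {M M' : Term R} : StepACl M M' → StepACl (smul a M) (smul a M')
  | ctxAppR {V M M' : Term R} : IsValue V → StepACl M M' → StepACl (app V M) (app V M')

section NonAC

variable [CommRing R]

/-- Steps of `→a` performed by a rule other than associativity or commutativity of `+`
    (closed under the ξ contexts). -/
inductive StepNAa : Term R → Term R → Prop
  | factor (a b : R) (M : Term R) : StepNAa (add (smul a M) (smul b M)) (smul (a + b) M)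
  | factor1 (a : R) (M : Term R) : StepNAa (add (smul a M) M) (smul (a + 1) M)
  | factor11 (M : Term R) : StepNAa (add M M) (smul (1 + 1) M)
  | mulMul (a b : R) (M : Term R) : StepNAa (smul a (smul b M)) (smul (a * b) M)
  | mulDist (a : R) (M N : Term R) : StepNAa (smul a (add M N)) (add (smul a M) (smul a N))
  | oneSmul (M : Term R) : StepNAa (smul 1 M) M
  | zeroSmul (M : Term R) : StepNAa (smul 0 M) zero
  | smulZero (a : R) : StepNAa (smul a zero) zero
  | zeroAdd (M : Term R) : StepNAa (add zero M) M
  | appAdd (M N L : Term R) : StepNAa (app (add M N) L) (add (app M L) (app N L))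
  | appSmul (a : R) (M N : Term R) : StepNAa (app (smul a M) N) (smul a (app M N))
  | appZero (M : Term R) : StepNAa (app zero M) zero
  | ctxAppL {M M' : Term R} (N : Term R) : StepNAa M M' → StepNAa (app M N) (app M' N)
  | ctxAddL {M M' : Term R} (N : Term R) : StepNAa M M' → StepNAa (add M N) (add M' N)
  | ctxAddR {N N' : Term R} (M : Term R) : StepNAa N N' → StepNAa (add M N) (add M N')
  | ctxSmul (a : R) {M M' : Term R} : StepNAa M M' → StepNAa (smul a M) (smul a M')

/-- Steps of `→ℓ` performed by a rule other than associativity or commutativity of `+`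
    (closed under the ξ and ξ_lin contexts). -/
inductive StepNAl : Term R → Term R → Prop
  | factor (a b : R) (M : Term R) : StepNAl (add (smul a M) (smul b M)) (smul (a + b) M)
  | factor1 (a : R) (M : Term R) : StepNAl (add (smul a M) M) (smul (a + 1) M)
  | factor11 (M : Term R) : StepNAl (add M M) (smul (1 + 1) M)
  | mulMul (a b : R) (M : Term R) : StepNAl (smul a (smul b M)) (smul (a * b) M)
  | mulDist (a : R) (M N : Term R) : StepNAl (smul a (add M N)) (add (smul a M) (smul a N))
  | oneSmul (M : Term R) : StepNAl (smul 1 M) M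
  | zeroSmul (M : Term R) : StepNAl (smul 0 M) zero
  | smulZero (a : R) : StepNAl (smul a zero) zero
  | zeroAdd (M : Term R) : StepNAl (add zero M) M
  | appAddV {V : Term R} (M N : Term R) : IsValue V →
      StepNAl (app (add M N) V) (add (app M V) (app N V))
  | appSmulV {V : Term R} (a : R) (M : Term R) : IsValue V →
      StepNAl (app (smul a M) V) (smul a (app M V))
  | appZeroV {V : Term R} : IsValue V → StepNAl (app zero V) zero
  | appAddB {B : Term R} (M N : Term R) : IsBase B →
      StepNAl (app B (add M N)) (add (app B M) (app B N))
  | appSmulB {B : Term R} (a : R) (M : Term R) : IsBase B →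
      StepNAl (app B (smul a M)) (smul a (app B M))
  | appZeroB {B : Term R} : IsBase B → StepNAl (app B zero) zero
  | ctxAppL {M M' : Term R} (N : Term R) : StepNAl M M' → StepNAl (app M N) (app M' N)
  | ctxAddL {M M' : Term R} (N : Term R) : StepNAl M M' → StepNAl (add M N) (add M' N)
  | ctxAddR {N N' : Term R} (M : Term R) : StepNAl N N' → StepNAl (add M N) (add M N')
  | ctxSmul (a : R) {M M' : Term R} : StepNAl M M' → StepNAl (smul a M) (smul a M')
  | ctxAppR {V M M' : Term R} : IsValue V → StepNAl M M' → StepNAl (app V M) (app V M')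

end NonAC

/-- The call-by-value-to-call-by-name encoding `M ↦ M~`.
    The fresh variables `f`, `g`, `h` are handled by de Bruijn lifting. -/
def cbvEnc : Term R → Term R
  | var n => lam (app (var 0) (var (n + 1)))
  | zero => zero
  | lam M => lam (app (var 0) (lift 0 (lam (cbvEnc M))))
  | app M N =>
      lam (app (lift 0 (cbvEnc M))
        (lam (app (lift 0 (lift 0 (cbvEnc N)))
          (lam (app (app (var 1) (var 0)) (var 2))))))
  | smul a M => lam (app (smul a (lift 0 (cbvEnc M))) (var 0))
  | add M N => lam (app (add (lift 0 (cbvEnc M)) (lift 0 (cbvEnc N))) (var 0))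

/-- The value encoding `Ψ` (its value on non-values is irrelevant). -/
def psi : Term R → Term R
  | var n => var n
  | zero => zero
  | lam M => lam (cbvEnc M)
  | smul a V => smul a (psi V)
  | add V W => add (psi V) (psi W)
  | app M N => app (psi M) (psi N)

/-- The call-by-name-to-call-by-value encoding `M ↦ ⟦M⟧`. -/
def cbnEnc : Term R → Term R
  | var n => var n
  | zero => lam (app zero (var 0))
  | lam M => lam (app (var 0) (lift 0 (lam (cbnEnc M))))
  | app M N =>
      lam (app (lift 0 (cbnEnc M))
        (lam (app (app (var 0) (lift 0 (lift 0 (cbnEnc N)))) (var 1))))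
  | smul a M => lam (app (smul a (lift 0 (cbnEnc M))) (var 0))
  | add M N => lam (app (add (lift 0 (cbnEnc M)) (lift 0 (cbnEnc N))) (var 0))

/-- The value encoding `Φ` (its value on non-values is irrelevant). -/
def phi : Term R → Term R
  | var n => app (var n) (lam (var 0))
  | zero => zero
  | lam M => lam (cbnEnc M)
  | smul a V => smul a (phi V)
  | add V W => add (phi V) (phi W)
  | app M N => app (phi M) (phi N)

/-- A measure on terms used to define the administrative operation `(:)`. -/
def size : Term R → ℕ
  | var _ => 1
  | lam _ => 1
  | zero => 1
  | smul _ M => 1 + size M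
  | add M N => 1 + size M + size N
  | app M N => size M * (size N + 1)

theorem size_pos : ∀ M : Term R, 0 < size M
  | var _ => Nat.one_pos
  | lam _ => Nat.one_pos
  | zero => Nat.one_pos
  | smul _ M => by simp [size]
  | add M N => by simp [size]
  | app M N => Nat.mul_pos (size_pos M) (Nat.succ_pos _)

/-- The administrative infix operation `(:)` of the call-by-value to call-by-name
    simulation: `colon M K` is `M : K`. -/
def colon : Term R → Term R → Term R
  | zero, _ => zero
  | var n, K => app K (var n)
  | lam M, K => app K (lam (cbvEnc M))
  | smul a M, K => smul a (colon M K)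
  | add M N, K => add (colon M K) (colon N K)
  | app zero _, _ => zero
  | app (var n) N, K =>
      colon N (lam (app (app (var (n + 1)) (var 0)) (lift 0 K)))
  | app (lam M) N, K =>
      colon N (lam (app (app (lift 0 (lam (cbvEnc M))) (var 0)) (lift 0 K)))
  | app (smul a M) N, K => smul a (colon (app M N) K)
  | app (add M M') N, K => add (colon (app M N) K) (colon (app M' N) K)
  | app (app M M') L, K =>
      colon (app M M')
        (lam (app (lift 0 (cbvEnc L))
          (lam (app (app (var 1) (var 0)) (lift 0 (lift 0 K))))))
termination_by M _ => size M
decreasing_by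
  all_goals simp only [size]
  · omega
  · omega
  · omega
  · nlinarith [size_pos N]
  · nlinarith [size_pos N]
  · nlinarith [size_pos M, size_pos N]
  · nlinarith [size_pos M, size_pos M', size_pos N]
  · nlinarith [size_pos M, size_pos M', size_pos N]
  · nlinarith [size_pos L, Nat.mul_pos (size_pos M) (Nat.succ_pos (size M'))]



section Equalities

variable [CommRing R]

/-- The restricted algebraic equality `=ℓ^F` on a fragment `F`. -/
def EqL (F : Set (Term R)) (M N : Term R) : Prop :=
  M ∈ F ∧ N ∈ F ∧ (StepL M N ∨ StepL N M)

/-- The relation `=ℓ∪β^F` : restricted algebraic equality together with `→βv` restricted to `F`. -/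
def EqLB (F : Set (Term R)) (M N : Term R) : Prop :=
  EqL F M N ∨ (M ∈ F ∧ N ∈ F ∧ StepBv M N)

/-- The restricted algebraic equality `=a^F` on a fragment `F`. -/
def EqA (F : Set (Term R)) (M N : Term R) : Prop :=
  M ∈ F ∧ N ∈ F ∧ (StepA M N ∨ StepA N M)

/-- The relation `=a∪β^F` : restricted algebraic equality together with `→βn` restricted to `F`. -/
def EqAB (F : Set (Term R)) (M N : Term R) : Prop :=
  EqA F M N ∨ (M ∈ F ∧ N ∈ F ∧ StepBn M N)

/-- The unrestricted algebraic equality `=ℓ` (symmetric closure of `→ℓ`). -/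
def EqLfull (M N : Term R) : Prop := StepL M N ∨ StepL N M

/-- The unrestricted relation `=ℓ∪β`. -/
def EqLBfull (M N : Term R) : Prop := EqLfull M N ∨ StepBv M N

/-- The unrestricted algebraic equality `=a` (symmetric closure of `→a`). -/
def EqAfull (M N : Term R) : Prop := StepA M N ∨ StepA N M

/-- The unrestricted relation `=a∪β`. -/
def EqABfull (M N : Term R) : Prop := EqAfull M N ∨ StepBn M N

end Equalities

section Substitution

theorem lift_lift (M : Term R) {i j : ℕ} (h : i ≤ j) :
    lift i (lift j M) = lift (j + 1) (lift i M) := by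
  induction M generalizing i j with
  | var n => simp only [lift]; split_ifs <;> simp only [lift] <;> split_ifs <;> first | rfl | omega
  | lam M ih => simp only [lift, ih (Nat.succ_le_succ h)]
  | app M N ihM ihN => simp only [lift, ihM h, ihN h]
  | zero => rfl
  | smul a M ih => simp only [lift, ih h]
  | add M N ihM ihN => simp only [lift, ihM h, ihN h]

theorem subst_lift (M N : Term R) (d : ℕ) : subst d N (lift d M) = M := by
  induction M generalizing d N with
  | var n =>
    simp only [lift]
    split_ifs <;> simp only [subst] <;> split_ifs <;> first | rfl | omega
  | lam M ih => simp only [lift, subst, ih]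
  | app M L ihM ihL => simp only [lift, subst, ihM, ihL]
  | zero => rfl
  | smul a M ih => simp only [lift, subst, ih]
  | add M L ihM ihL => simp only [lift, subst, ihM, ihL]

theorem lift_subst (M N : Term R) {k d : ℕ} (h : k ≤ d) :
    lift k (subst d N M) = subst (d + 1) (lift k N) (lift k M) := by
  induction M generalizing k d N with
  | var n =>
    rcases lt_trichotomy n d with hn | rfl | hn
    · by_cases hk : n < k
      · simp [lift, subst, hn, hk, Nat.lt_succ_of_lt hn]
      · simp [lift, subst, hn, hk]
    · simp [lift, subst, Nat.not_lt.2 h]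
    · obtain ⟨m, rfl⟩ : ∃ m, n = m + 1 := ⟨n - 1, by omega⟩
      have h₁ : ¬ m + 1 < d := by omega
      have h₂ : ¬ m + 1 = d := by omega
      have h₃ : ¬ m < k := by omega
      have h₄ : ¬ m + 1 < k := by omega
      simp [lift, subst, h₁, h₂, h₃, h₄]
  | lam M ih =>
    simp only [lift, subst, ih _ (Nat.succ_le_succ h), lift_lift N (Nat.zero_le k)]
  | app M L ihM ihL => simp only [lift, subst, ihM _ h, ihL _ h]
  | zero => rfl
  | smul a M ih => simp only [lift, subst, ih _ h]
  | add M L ihM ihL => simp only [lift, subst, ihM _ h, ihL _ h]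

theorem cbnEnc_lift (M : Term R) (d : ℕ) : cbnEnc (lift d M) = lift d (cbnEnc M) := by
  induction M generalizing d with
  | var n => simp only [lift, cbnEnc]; split_ifs <;> rfl
  | lam M ih =>
    simp [lift, cbnEnc, ih, lift_lift _ (Nat.succ_le_succ (Nat.zero_le d))]
  | app M N ihM ihN =>
    simp [lift, cbnEnc, ihM, ihN, lift_lift _ (Nat.zero_le d),
      lift_lift _ (Nat.zero_le (d + 1))]
  | zero => simp [lift, cbnEnc]
  | smul a M ih => simp [lift, cbnEnc, ih, lift_lift _ (Nat.zero_le d)]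
  | add M N ihM ihN => simp [lift, cbnEnc, ihM, ihN, lift_lift _ (Nat.zero_le d)]

theorem cbnEnc_subst (M N : Term R) (d : ℕ) :
    cbnEnc (subst d N M) = subst d (cbnEnc N) (cbnEnc M) := by
  induction M generalizing d N with
  | var n => simp only [subst, cbnEnc]; split_ifs <;> rfl
  | lam M ih =>
    simp [subst, lift, cbnEnc, ih, cbnEnc_lift,
      lift_subst _ _ (Nat.succ_le_succ (Nat.zero_le d)), lift_lift _ (Nat.zero_le 0)]
  | app M L ihM ihL => simp [subst, cbnEnc, ihM, ihL, lift_subst _ _ (Nat.zero_le _)]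
  | zero => simp [subst, cbnEnc]
  | smul a M ih => simp [subst, cbnEnc, ih, lift_subst _ _ (Nat.zero_le _)]
  | add M L ihM ihL => simp [subst, cbnEnc, ihM, ihL, lift_subst _ _ (Nat.zero_le _)]

end Substitution

theorem isBase_cbnEnc : ∀ M : Term R, IsBase (cbnEnc M)
  | var n => .var n
  | lam _ => .lam _
  | app _ _ => .lam _
  | zero => .lam _
  | smul _ _ => .lam _
  | add _ _ => .lam _

/-- The continuation `λg.((g) ⟦N⟧) K` which evaluates an application to `N` and resumes with `K`. -/
def argCont (N K : Term R) : Term R :=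
  lam (app (app (var 0) (lift 0 (cbnEnc N))) (lift 0 K))

/-- The administrative operation `M : K` of the call-by-name to call-by-value simulation:
    the result of the administrative reductions of `(⟦M⟧) K`. -/
def cbnColon : Term R → Term R → Term R
  | var n, K => app (var n) K
  | lam M, K => app K (lam (cbnEnc M))
  | app M N, K => cbnColon M (argCont N K)
  | zero, _ => zero
  | smul a M, K => smul a (cbnColon M K)
  | add M N, K => add (cbnColon M K) (cbnColon N K)

section Simulation

open Relation

variable [CommRing R]

theorem StepLB.ctxAppL {M M' : Term R} (N : Term R) :
    StepLB M M' → StepLB (app M N) (app M' N) :=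
  Or.imp (.ctxAppL N) (.ctxAppL N)

theorem StepLB.ctxAddL {M M' : Term R} (N : Term R) :
    StepLB M M' → StepLB (add M N) (add M' N) :=
  Or.imp (.ctxAddL N) (.ctxAddL N)

theorem StepLB.ctxAddR {N N' : Term R} (M : Term R) :
    StepLB N N' → StepLB (add M N) (add M N') :=
  Or.imp (.ctxAddR M) (.ctxAddR M)

theorem StepLB.ctxSmul (a : R) {M M' : Term R} :
    StepLB M M' → StepLB (smul a M) (smul a M') :=
  Or.imp (.ctxSmul a) (.ctxSmul a)

theorem reflTransGen_stepLB_add {M M' N N' : Term R} (hM : ReflTransGen StepLB M M')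
    (hN : ReflTransGen StepLB N N') : ReflTransGen StepLB (add M N) (add M' N') :=
  (hM.lift (add · N) fun _ _ => .ctxAddL N).trans (hN.lift (add M') fun _ _ => .ctxAddR M')

theorem reflTransGen_stepLB_smul (a : R) {M M' : Term R} (h : ReflTransGen StepLB M M') :
    ReflTransGen StepLB (smul a M) (smul a M') :=
  h.lift (smul a) fun _ _ => .ctxSmul a

theorem reflGen_stepL_map {f : Term R → Term R}
    (hf : ∀ M N, StepL M N → StepL (f M) (f N)) {M N : Term R} (h : ReflGen StepL M N) :
    ReflGen StepL (f M) (f N) := by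
  cases h with
  | refl => exact .refl
  | single h => exact .single (hf _ _ h)

theorem stepLB_beta (M : Term R) {B : Term R} (hB : IsBase B) :
    StepLB (app (lam M) B) (subst 0 B M) :=
  .inr (.beta M hB)

/-- The administrative reductions: `(⟦M⟧) K` reduces to `M : K`. -/
theorem reflTransGen_cbnColon (M : Term R) {K : Term R} (hK : IsBase K) :
    ReflTransGen StepLB (app (cbnEnc M) K) (cbnColon M K) := by
  induction M generalizing K with
  | var n => exact .refl
  | lam M =>
    have h := stepLB_beta (app (var 0) (lift 0 (lam (cbnEnc M)))) hK
    rw [subst, subst_lift] at h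
    exact .single h
  | app M N ih =>
    have h := stepLB_beta (app (lift 0 (cbnEnc M))
      (lam (app (app (var 0) (lift 0 (lift 0 (cbnEnc N)))) (var 1)))) hK
    rw [lift_lift (cbnEnc N) le_rfl] at h
    simp only [subst, subst_lift] at h
    rw [cbnEnc, lift_lift (cbnEnc N) le_rfl]
    exact .head h (ih (.lam _))
  | zero => exact .head (stepLB_beta _ hK) (.single (.inl (.appZeroV (.base hK))))
  | smul a M ih =>
    have h := stepLB_beta (app (smul a (lift 0 (cbnEnc M))) (var 0)) hK
    simp only [subst, subst_lift] at h
    exact .head h (.head (.inl (.appSmulV _ _ (.base hK))) (reflTransGen_stepLB_smul a (ih hK)))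
  | add M N ihM ihN =>
    have h := stepLB_beta (app (add (lift 0 (cbnEnc M)) (lift 0 (cbnEnc N))) (var 0)) hK
    simp only [subst, subst_lift] at h
    exact .head h (.head (.inl (.appAddV _ _ (.base hK)))
      (reflTransGen_stepLB_add (ihM hK) (ihN hK)))

/-- `M ↦ M : K` maps `→a` steps to at most one `→ℓ` step. -/
theorem StepA.cbnColon {M M' : Term R} (h : StepA M M') (K : Term R) :
    ReflGen StepL (cbnColon M K) (cbnColon M' K) := by
  induction h generalizing K with
  | assocL => exact .single (.assocL _ _ _)
  | assocR => exact .single (.assocR _ _ _)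
  | comm => exact .single (.comm _ _)
  | factor => exact .single (.factor _ _ _)
  | factor1 => exact .single (.factor1 _ _)
  | factor11 => exact .single (.factor11 _)
  | mulMul => exact .single (.mulMul _ _ _)
  | mulDist => exact .single (.mulDist _ _ _)
  | oneSmul => exact .single (.oneSmul _)
  | zeroSmul => exact .single (.zeroSmul _)
  | smulZero => exact .single (.smulZero _)
  | zeroAdd => exact .single (.zeroAdd _)
  | appAdd | appSmul | appZero => exact .refl
  | ctxAppL N _ ih => exact ih _
  | ctxAddL N _ ih => exact reflGen_stepL_map (f := (add · _)) (fun _ _ => .ctxAddL _) (ih K)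
  | ctxAddR M _ ih => exact reflGen_stepL_map (fun _ _ => .ctxAddR _) (ih K)
  | ctxSmul a _ ih => exact reflGen_stepL_map (fun _ _ => .ctxSmul a) (ih K)

theorem StepBn.cbnColon {M M' : Term R} (h : StepBn M M') {K : Term R} (hK : IsBase K) :
    ReflTransGen StepLB (cbnColon M K) (cbnColon M' K) := by
  induction h generalizing K with
  | beta M N =>
    have h₁ := stepLB_beta (app (app (var 0) (lift 0 (cbnEnc N))) (lift 0 K))
      (.lam (cbnEnc M))
    have h₂ := stepLB_beta (cbnEnc M) (isBase_cbnEnc N)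
    simp only [subst, subst_lift] at h₁
    rw [← cbnEnc_subst] at h₂
    exact .head h₁ (.head (h₂.ctxAppL K) (reflTransGen_cbnColon _ hK))
  | ctxAppL N _ ih => exact ih (.lam _)
  | ctxAddL N _ ih => exact reflTransGen_stepLB_add (ih hK) .refl
  | ctxAddR M _ ih => exact reflTransGen_stepLB_add .refl (ih hK)
  | ctxSmul a _ ih => exact reflTransGen_stepLB_smul a (ih hK)

theorem IsValue.cbnColon_phi {V : Term R} (hV : IsValue V) :
    ReflTransGen StepLB (cbnColon V (lam (var 0))) (phi V) := by
  induction hV with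
  | zero => exact .refl
  | base hB =>
    cases hB with
    | var n => exact .refl
    | lam M => exact .single (stepLB_beta (var 0) (.lam _))
  | smul a _ ih => exact reflTransGen_stepLB_smul a ih
  | add _ _ ihV ihW => exact reflTransGen_stepLB_add ihV ihW

theorem mem_of_reflTransGen_stepLB {F : Set (Term R)}
    (hF : ∀ M ∈ F, ∀ N, StepLB M N → N ∈ F) {M N : Term R} (hM : M ∈ F)
    (h : ReflTransGen StepLB M N) : N ∈ F := by
  induction h with
  | refl => exact hM
  | tail _ hs ih => exact hF _ ih _ hs

theorem reflTransGen_eqLB_of_stepLB {F : Set (Term R)}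
    (hF : ∀ M ∈ F, ∀ N, StepLB M N → N ∈ F) {M N : Term R} (hM : M ∈ F)
    (h : ReflTransGen StepLB M N) : ReflTransGen (EqLB F) M N := by
  induction h with
  | refl => exact .refl
  | tail hMN hs ih =>
    have hN := mem_of_reflTransGen_stepLB hF hM hMN
    exact ih.tail (hs.imp (fun h => ⟨hN, hF _ hN _ hs, .inl h⟩) fun h => ⟨hN, hF _ hN _ hs, h⟩)

theorem reflTransGen_eqLB_of_reflGen_stepL {F : Set (Term R)} {M N : Term R} (hM : M ∈ F)
    (hN : N ∈ F) (h : ReflGen StepL M N ∨ ReflGen StepL N M) :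
    ReflTransGen (EqLB F) M N := by
  rcases h with h | h <;> cases h with
  | refl => exact .refl
  | single h => exact .single (.inl ⟨hM, hN, by tauto⟩)

end Simulation

section Statements

variable [CommRing R]

/-- simulation of call-by-name algebraic equality by call-by-value
algebraic equality, relative to fragments `Sa` and `Sl` with
`(⟦M⟧) λx.x ∈ Sl` for all `M ∈ Sa`. -/
theorem simulation_cbn_eq_by_cbv_eq (Sa Sl : Set (Term R))
    (hSa : ∀ M ∈ Sa, ∀ N, StepAB M N → N ∈ Sa)
    (hSl : ∀ M ∈ Sl, ∀ N, StepLB M N → N ∈ Sl)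
    (henc : ∀ M ∈ Sa, app (cbnEnc M) (lam (var 0)) ∈ Sl)
    (M V : Term R) (hM : M ∈ Sa) (hMc : Closed M) (hV : IsValue V)
    (h : Relation.ReflTransGen (EqAB Sa) M V) :
    Relation.ReflTransGen (EqLB Sl) (app (cbnEnc M) (lam (var 0))) (phi V) := by
  have hI : IsBase (lam (var 0) : Term R) := .lam _
  have hmem : ∀ N ∈ Sa, cbnColon N (lam (var 0)) ∈ Sl := fun N hN =>
    mem_of_reflTransGen_stepLB hSl (henc N hN) (reflTransGen_cbnColon N hI)
  have key : V ∈ Sa ∧ Relation.ReflTransGen (EqLB Sl) (app (cbnEnc M) (lam (var 0)))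
      (cbnColon V (lam (var 0))) := by
    clear hV
    induction h with
    | refl =>
      exact ⟨hM, reflTransGen_eqLB_of_stepLB hSl (henc M hM) (reflTransGen_cbnColon M hI)⟩
    | tail _ hs ih =>
      rcases hs with ⟨h₁, h₂, hs⟩ | ⟨h₁, h₂, hs⟩
      · exact ⟨h₂, ih.2.trans (reflTransGen_eqLB_of_reflGen_stepL (hmem _ h₁) (hmem _ h₂)
          (hs.imp (·.cbnColon _) (·.cbnColon _)))⟩
      · exact ⟨h₂, ih.2.trans (reflTransGen_eqLB_of_stepLB hSl (hmem _ h₁) (hs.cbnColon hI))⟩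
  exact key.2.trans (reflTransGen_eqLB_of_stepLB hSl (hmem V key.1) hV.cbnColon_phi)

end Statements

end Term

end AlgLam
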